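/- Let 0 < p < ∞ and let f ∈ E^p. Then the function f_π(z) = e^{iπz} f(z), restricted to the upper half-plane ℂ_+, satisfies sup_{y>0} ∫_ℝ |f_π(x+iy)|^p dx = ∫_ℝ |f(x)|^p dx, and the function f_{-π}(z) = e^{-iπz} f(z), restricted to the lower half-plane ℂ_-, satisfies sup_{y<0} ∫_ℝ |f_{-π}(x+iy)|^p dx = ∫_ℝ |f(x)|^p dx. In particular f ↦ f_π is an isometry of E^p into H^p(ℂ_+) and f ↦ f_{-π} is an isometry of E^p into H^p(ℂ_-). -/

import Mathlib

open MeasureTheory Real Complex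
open scoped ENNReal NNReal

/-- An entire function of exponential type `π`. -/
def ExpTypePi (f : ℂ → ℂ) : Prop :=
  Differentiable ℂ f ∧
    ∀ ε > 0, ∃ C > 0, ∀ z : ℂ, ‖f z‖ ≤ C * Real.exp ((Real.pi + ε) * ‖z‖)

theorem submean_norm_rpow {p : ℝ} (hp : 0 < p) {g : ℂ → ℂ} {c : ℂ} {r : ℝ} (hr : 0 < r)
    (hg : AnalyticOnNhd ℂ g (Metric.closedBall c r)) :
    ‖g c‖ ^ p ≤ circleAverage (fun z => ‖g z‖ ^ p) c r := by
  have hcont : ContinuousOn (fun z => ‖g z‖ ^ p) (Metric.sphere c |r|) := by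
    rw [abs_of_pos hr]
    exact ((hg.continuousOn.mono Metric.sphere_subset_closedBall).norm).rpow_const
      (fun _ _ => Or.inr hp.le)
  have hpint : CircleIntegrable (fun z => ‖g z‖ ^ p) c r := hcont.circleIntegrable'
  by_cases h0 : g c = 0
  · rw [h0, norm_zero, Real.zero_rpow hp.ne']
    exact circleAverage_nonneg_of_nonneg (fun z _ => by positivity)
  have hrr : |r| = r := abs_of_pos hr
  have hg' : AnalyticOnNhd ℂ g (Metric.closedBall c |r|) := by rwa [hrr]
  have hJ := hg'.circleAverage_log_norm hr.ne' h0
  have hlog : Real.log ‖g c‖ ≤ circleAverage (Real.log ‖g ·‖) c r := by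
    rw [hJ]
    have : 0 ≤ ∑ᶠ u, (MeromorphicOn.divisor g (Metric.closedBall c |r|) u : ℝ) *
        Real.log (r * ‖c - u‖⁻¹) := by
      apply finsum_nonneg
      intro u
      by_cases hu : u ∈ Metric.closedBall c |r|
      · apply mul_nonneg
        · exact_mod_cast MeromorphicOn.AnalyticOnNhd.divisor_nonneg hg' u
        · rcases eq_or_ne u c with rfl | huc
          · simp
          apply Real.log_nonneg
          rw [← div_eq_mul_inv, one_le_div (norm_pos_iff.2 (sub_ne_zero.2 huc.symm))]
          rw [hrr, Metric.mem_closedBall, dist_comm, dist_eq_norm] at hu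
          exact hu
      · simp [hu]
    linarith
  set L := p * Real.log ‖g c‖ with hL
  classical
  let G : ℂ → ℝ := fun z => if g z = 0 then (L - 1) / p else Real.log ‖g z‖
  have hne : (Real.log ‖g ·‖) =ᶠ[Filter.codiscreteWithin (Metric.sphere c |r|)] G := by
    have h1 : {z | g z ≠ 0} ∈ Filter.codiscreteWithin (Metric.sphere c |r|) := by
      rw [mem_codiscreteWithin]
      intro x hx
      have hxb : x ∈ Metric.closedBall c |r| := Metric.sphere_subset_closedBall hx
      rcases (hg' x hxb).eventually_eq_zero_or_eventually_ne_zero with h | h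
      · exfalso
        apply h0
        exact hg'.eqOn_zero_of_preconnected_of_eventuallyEq_zero
          (convex_closedBall c |r|).isPreconnected hxb h (by simp)
      · rw [Filter.disjoint_principal_right]
        filter_upwards [h] with z hz
        simp [hz]
    filter_upwards [h1] with z hz
    simp [G, show g z ≠ 0 from hz]
  have hGi : CircleIntegrable G c r :=
    CircleIntegrable.congr_codiscreteWithin hne
      (MeromorphicOn.circleIntegrable_log_norm
        (hg'.mono Metric.sphere_subset_closedBall).meromorphicOn)
  rw [circleAverage_congr_codiscreteWithin hne hr.ne'] at hlog
  have hLe : ‖g c‖ ^ p = Real.exp L := by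
    rw [Real.rpow_def_of_pos (norm_pos_iff.2 h0), hL, mul_comm]
  have hpt : ∀ z, Real.exp L * p * G z + Real.exp L * (1 - L) ≤ ‖g z‖ ^ p := by
    intro z
    by_cases hz : g z = 0
    · simp only [G, hz, if_true, norm_zero, Real.zero_rpow hp.ne']
      field_simp
      nlinarith [Real.exp_pos L]
    · simp only [G, hz, if_false]
      rw [Real.rpow_def_of_pos (norm_pos_iff.2 hz)]
      have := Real.add_one_le_exp (Real.log ‖g z‖ * p - L)
      rw [Real.exp_sub, le_div_iff₀ (Real.exp_pos L)] at this
      nlinarith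
  have e1 : circleAverage (fun z => (Real.exp L * p) • G z + Real.exp L * (1 - L)) c r
      = Real.exp L * p * circleAverage G c r + Real.exp L * (1 - L) := by
    rw [circleAverage_fun_add (CircleIntegrable.const_fun_smul hGi) (circleIntegrable_const _ _ _),
      circleAverage_const, circleAverage_fun_smul, smul_eq_mul]
  have e2 := circleAverage_mono (f₁ := fun z => (Real.exp L * p) • G z + Real.exp L * (1 - L))
    ((CircleIntegrable.const_fun_smul hGi).add (circleIntegrable_const _ _ _)) hpint
    (fun z _ => hpt z)
  rw [e1] at e2
  rw [hLe]
  refine le_trans ?_ e2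
  have : Real.exp L * p * Real.log ‖g c‖ ≤ Real.exp L * p * circleAverage G c r := by gcongr
  nlinarith [Real.exp_pos L]

theorem max_principle {Ω : Set ℂ} (hΩ : IsOpen Ω) {v : ℂ → ℝ} (hv : ContinuousOn v (closure Ω))
    (hsub : ∀ c ∈ Ω, ∀ r > 0, Metric.closedBall c r ⊆ Ω → v c ≤ circleAverage v c r)
    {M R : ℝ} (hfr : ∀ z ∈ closure Ω, z ∉ Ω → v z ≤ M)
    (hR : ∀ z ∈ Ω, R ≤ ‖z‖ → v z ≤ M) : ∀ z ∈ Ω, v z ≤ M := by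
  intro z0 hz0
  by_contra hcon
  push Not at hcon
  have hK : IsCompact (closure Ω ∩ Metric.closedBall 0 R) :=
    (isCompact_closedBall 0 R).inter_left isClosed_closure
  have hz0K : z0 ∈ closure Ω ∩ Metric.closedBall 0 R := by
    refine ⟨subset_closure hz0, ?_⟩
    rw [mem_closedBall_zero_iff]
    by_contra h
    exact absurd (hR z0 hz0 (not_le.1 h).le) (not_le.2 hcon)
  obtain ⟨z1, hz1, hmax⟩ := hK.exists_isMaxOn ⟨z0, hz0K⟩ (hv.mono Set.inter_subset_left)
  set m := v z1 with hm
  have hmM : M < m := lt_of_lt_of_le hcon (hmax hz0K)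
  have hall : ∀ z ∈ Ω, v z ≤ m := by
    intro z hz
    by_cases h : ‖z‖ ≤ R
    · exact hmax ⟨subset_closure hz, by simpa using h⟩
    · exact (hR z hz (not_le.1 h).le).trans hmM.le
  have hS : IsCompact {z ∈ closure Ω ∩ Metric.closedBall 0 R | v z = m} := by
    have h2 : IsClosed ((closure Ω ∩ Metric.closedBall 0 R) ∩ v ⁻¹' {m}) :=
      (hv.mono Set.inter_subset_left).preimage_isClosed_of_isClosed hK.isClosed isClosed_singleton
    exact hK.of_isClosed_subset h2 Set.inter_subset_left
  obtain ⟨z2, ⟨hz2K, hz2m⟩, hz2max⟩ := hS.exists_isMaxOn ⟨z1, hz1, rfl⟩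
    Complex.continuous_re.continuousOn
  have hz2 : z2 ∈ Ω := by
    by_contra h
    have := hfr z2 hz2K.1 h
    linarith
  obtain ⟨r, hr, hball⟩ := Metric.nhds_basis_closedBall.mem_iff.1 (hΩ.mem_nhds hz2)
  have h1 := hsub z2 hz2 r hr hball
  have hmem : ∀ θ, circleMap z2 r θ ∈ Ω := fun θ =>
    hball (circleMap_mem_closedBall _ hr.le θ)
  have h2 : (∫ θ in (0 : ℝ)..2 * π, v (circleMap z2 r θ)) < ∫ θ in (0 : ℝ)..2 * π, m := by
    apply intervalIntegral.integral_lt_integral_of_continuousOn_of_le_of_exists_lt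
      Real.two_pi_pos _ continuousOn_const (fun θ _ => hall _ (hmem θ))
    · refine ⟨0, ⟨le_rfl, Real.two_pi_pos.le⟩, ?_⟩
      refine lt_of_le_of_ne (hall _ (hmem 0)) ?_
      intro heq
      have hre : (circleMap z2 r 0).re = z2.re + r := by simp [circleMap]
      have hin : circleMap z2 r 0 ∈ {z ∈ closure Ω ∩ Metric.closedBall 0 R | v z = m} := by
        refine ⟨⟨subset_closure (hmem 0), ?_⟩, heq⟩
        rw [mem_closedBall_zero_iff]
        by_contra h
        have := hR _ (hmem 0) (not_le.1 h).le
        linarith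
      have := hz2max hin
      simp only [Set.mem_ofPred_eq, hre] at this
      linarith
    · exact (hv.comp_continuous (continuous_circleMap z2 r)
        (fun θ => subset_closure (hmem θ))).continuousOn
  rw [hz2m, circleAverage_def, smul_eq_mul, inv_mul_eq_div, le_div_iff₀ Real.two_pi_pos] at h1
  rw [intervalIntegral.integral_const, smul_eq_mul] at h2
  linarith

/-- local mass -/
noncomputable def locMass (p N : ℝ) (f : ℂ → ℂ) (z : ℂ) : ℝ := ∫ t in (-N)..N, ‖f (z + t)‖ ^ p

theorem locMass_continuous {p N : ℝ} (hp : 0 < p) {f : ℂ → ℂ} (hf : Differentiable ℂ f) :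
    Continuous (locMass p N f) := by
  apply intervalIntegral.continuous_parametric_intervalIntegral_of_continuous'
  have := hf.continuous
  refine Continuous.rpow_const ?_ (fun _ => Or.inr hp.le)
  fun_prop

theorem submean_locMass {p N : ℝ} (hp : 0 < p) (hN : 0 ≤ N) {f h : ℂ → ℂ} (hf : Differentiable ℂ f)
    {Ω : Set ℂ} (hΩ : IsOpen Ω) (hh : DifferentiableOn ℂ h Ω) {c : ℂ} {r : ℝ} (hr : 0 < r)
    (hb : Metric.closedBall c r ⊆ Ω) :
    locMass p N f c * Real.exp (p * (h c).re) ≤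
      circleAverage (fun z => locMass p N f z * Real.exp (p * (h z).re)) c r := by
  have key : ∀ z, locMass p N f z * Real.exp (p * (h z).re) =
      ∫ t in (-N)..N, ‖f (z + t) * Complex.exp (h z)‖ ^ p := by
    intro z
    rw [locMass, ← intervalIntegral.integral_mul_const]
    congr 1
    ext t
    rw [norm_mul, Real.mul_rpow (norm_nonneg _) (norm_nonneg _), Complex.norm_exp,
      ← Real.exp_mul, mul_comm p]
  have hmem : ∀ θ, circleMap c r θ ∈ Ω := fun θ => hb (circleMap_mem_closedBall _ hr.le θ)
  have hhc : Continuous (fun θ => h (circleMap c r θ)) :=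
    hh.continuousOn.comp_continuous (continuous_circleMap c r) hmem
  have hfc := hf.continuous
  have hF : Continuous (Function.uncurry (fun (t θ : ℝ) =>
      ‖f (circleMap c r θ + t) * Complex.exp (h (circleMap c r θ))‖ ^ p)) := by
    refine Continuous.rpow_const ?_ (fun _ => Or.inr hp.le)
    have h2 : Continuous (fun q : ℝ × ℝ => h (circleMap c r q.2)) := hhc.comp continuous_snd
    have h3 : Continuous (fun q : ℝ × ℝ => circleMap c r q.2) :=
      (continuous_circleMap c r).comp continuous_snd
    have h4 : Continuous (fun q : ℝ × ℝ => f (circleMap c r q.2 + q.1)) :=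
      hfc.comp (h3.add (Complex.continuous_ofReal.comp continuous_fst))
    exact (h4.mul (Complex.continuous_exp.comp h2)).norm
  have hpt : ∀ t : ℝ, ‖f (c + t) * Complex.exp (h c)‖ ^ p ≤
      (2 * π)⁻¹ * ∫ θ in (0 : ℝ)..2 * π,
        ‖f (circleMap c r θ + t) * Complex.exp (h (circleMap c r θ))‖ ^ p := by
    intro t
    have := submean_norm_rpow hp (g := fun z => f (z + t) * Complex.exp (h z)) (c := c) hr ?_
    · simpa [circleAverage_def] using this
    · have hd : DifferentiableOn ℂ (fun z => f (z + t) * Complex.exp (h z)) Ω :=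
        (hf.comp (differentiable_id.add_const (t : ℂ))).differentiableOn.mul hh.cexp
      exact (hd.analyticOnNhd hΩ).mono hb
  simp only [key]
  rw [circleAverage_def, smul_eq_mul]
  have hswap : (∫ θ in (0 : ℝ)..2 * π, ∫ t in (-N)..N,
        ‖f (circleMap c r θ + t) * Complex.exp (h (circleMap c r θ))‖ ^ p) =
      ∫ t in (-N)..N, ∫ θ in (0 : ℝ)..2 * π,
        ‖f (circleMap c r θ + t) * Complex.exp (h (circleMap c r θ))‖ ^ p := by
    simp only [intervalIntegral.integral_of_le Real.two_pi_pos.le,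
      intervalIntegral.integral_of_le (show -N ≤ N by linarith)]
    symm
    apply MeasureTheory.integral_integral_swap
    rw [Measure.prod_restrict]
    exact (hF.continuousOn.integrableOn_compact (isCompact_Icc.prod isCompact_Icc)).mono_set
      (Set.prod_mono Set.Ioc_subset_Icc_self Set.Ioc_subset_Icc_self)
  rw [hswap, ← intervalIntegral.integral_const_mul]
  apply intervalIntegral.integral_mono_on (by linarith)
  · apply Continuous.intervalIntegrable
    refine Continuous.rpow_const ?_ (fun _ => Or.inr hp.le)
    fun_prop
  · apply Continuous.intervalIntegrable
    exact continuous_const.mul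
      (intervalIntegral.continuous_parametric_intervalIntegral_of_continuous' hF _ _)
  · intro t _
    exact hpt t

theorem locMass_nonneg {p N : ℝ} (hN : 0 ≤ N) (f : ℂ → ℂ) (z : ℂ) : 0 ≤ locMass p N f z :=
  intervalIntegral.integral_nonneg (by linarith) (fun _ _ => by positivity)

theorem re_cpow_bound {w : ℂ} (hw : |w.im| ≤ w.re) (hw1 : 0 < w.re) :
    ‖w‖ ^ (3 / 2 : ℝ) * Real.cos (3 * π / 8) ≤ (Complex.exp ((3 / 2 : ℝ) * Complex.log w)).re := by
  have hn : 0 < ‖w‖ := norm_pos_iff.2 (fun h => by simp [h] at hw1)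
  have harg : |w.arg| ≤ π / 4 := by
    have h2 : |w.arg| ≤ π / 2 := Complex.abs_arg_le_pi_div_two_iff.2 hw1.le
    rw [abs_le] at h2
    by_contra hc
    push Not at hc
    have hc0 : Real.cos |w.arg| < Real.cos (π / 4) :=
      Real.cos_lt_cos_of_nonneg_of_le_pi_div_two (by positivity) (abs_le.2 h2) hc
    rw [Real.cos_abs, Real.cos_pi_div_four, Complex.cos_arg (norm_pos_iff.1 hn),
      div_lt_iff₀ hn] at hc0
    have hsq : ‖w‖ ^ 2 = w.re ^ 2 + w.im ^ 2 := by
      rw [Complex.sq_norm, Complex.normSq_apply]; ring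
    have him : w.im ^ 2 ≤ w.re ^ 2 := sq_le_sq' (abs_le.1 hw).1 (abs_le.1 hw).2
    have h3 : w.re ^ 2 < (√2 / 2 * ‖w‖) ^ 2 := by gcongr
    rw [mul_pow, div_pow, Real.sq_sqrt (by norm_num), hsq] at h3
    linarith
  rw [Complex.exp_re]
  have e1 : (((3 / 2 : ℝ) : ℂ) * Complex.log w).re = Real.log ‖w‖ * (3 / 2) := by
    rw [Complex.re_ofReal_mul, Complex.log_re]; ring
  have e2 : (((3 / 2 : ℝ) : ℂ) * Complex.log w).im = 3 / 2 * w.arg := by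
    rw [Complex.im_ofReal_mul, Complex.log_im]
  rw [e1, e2, ← Real.rpow_def_of_pos hn]
  gcongr
  rw [← Real.cos_abs (3 / 2 * w.arg)]
  apply Real.cos_le_cos_of_nonneg_of_le_pi (abs_nonneg _) (by linarith [Real.pi_pos])
  rw [abs_mul, abs_of_pos (by norm_num : (0 : ℝ) < 3 / 2)]
  linarith

theorem le_of_forall_delta {x b c : ℝ} (h : ∀ δ > 0, x * Real.exp (-(δ * c)) ≤ b) : x ≤ b := by
  have hc : Continuous (fun δ : ℝ => x * Real.exp (-(δ * c))) := by fun_prop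
  have ht : Filter.Tendsto (fun δ : ℝ => x * Real.exp (-(δ * c))) (nhdsWithin 0 (Set.Ioi 0))
      (nhds x) := by
    have := (hc.tendsto 0).mono_left (nhdsWithin_le_nhds (s := Set.Ioi (0 : ℝ)))
    simpa using this
  exact le_of_tendsto ht (by filter_upwards [self_mem_nhdsWithin] with δ hδ using h δ hδ)

theorem quadrant_bound {p N a A M σ : ℝ} (hp : 0 < p) (hN : 0 ≤ N) (ha : 0 < a)
    (hσ : |σ| = 1) {f : ℂ → ℂ} (hf : Differentiable ℂ f)
    (hA : ∀ z, locMass p N f z ≤ A * Real.exp (p * a * ‖z‖))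
    (hM : ∀ x : ℝ, locMass p N f x ≤ M) (z : ℂ) (hz1 : 0 < σ * z.re) (hz2 : 0 < z.im) :
    locMass p N f z * Real.exp (-(p * a * z.im)) ≤ max A M := by
  have hA0 : 0 ≤ A := by
    have := (locMass_nonneg hN f 0).trans (hA 0)
    simpa using this
  have hM0 : 0 ≤ M := (locMass_nonneg hN f _).trans (hM 0)
  let w : ℂ → ℂ := fun z => 1 + (σ - Complex.I) * z
  have wre : ∀ z, (w z).re = 1 + σ * z.re + z.im := by intro z; simp [w]; ring
  have wim : ∀ z, (w z).im = σ * z.im - z.re := by intro z; simp [w]; ring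
  have wprop : ∀ z : ℂ, 0 ≤ σ * z.re → 0 ≤ z.im →
      |(w z).im| ≤ (w z).re ∧ 0 < (w z).re ∧ ‖z‖ ≤ ‖w z‖ := by
    intro z h1 h2
    have h3 : |z.re| = σ * z.re := by rw [← abs_of_nonneg h1, abs_mul, hσ, one_mul]
    have h5 : (w z).re ≤ ‖w z‖ := Complex.re_le_norm _
    have h6 := Complex.norm_le_abs_re_add_abs_im z
    rw [h3, abs_of_nonneg h2] at h6
    refine ⟨?_, ?_, ?_⟩
    · rw [wre, wim]
      refine (abs_sub _ _).trans ?_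
      rw [abs_mul, hσ, h3, abs_of_nonneg h2]; linarith
    · rw [wre]; linarith
    · rw [wre] at h5; linarith
  set κ := Real.cos (3 * π / 8) with hκ
  have hκ0 : 0 < κ := Real.cos_pos_of_mem_Ioo ⟨by linarith [Real.pi_pos], by linarith [Real.pi_pos]⟩
  let H : ℂ → ℂ := fun z => Complex.exp ((3 / 2 : ℝ) * Complex.log (w z))
  let Ω : Set ℂ := {z | 0 < σ * z.re ∧ 0 < z.im}
  have hcr : Continuous (fun z : ℂ => σ * z.re) := by fun_prop
  have hΩ : IsOpen Ω := (isOpen_lt continuous_const hcr).and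
    (isOpen_lt continuous_const Complex.continuous_im)
  have hcl : closure Ω ⊆ {z | 0 ≤ σ * z.re ∧ 0 ≤ z.im} := by
    apply closure_minimal
    · intro z hz; exact ⟨hz.1.le, hz.2.le⟩
    · exact (isClosed_le continuous_const hcr).and
        (isClosed_le continuous_const Complex.continuous_im)
  have hHd : ∀ z : ℂ, 0 ≤ σ * z.re → 0 ≤ z.im → DifferentiableAt ℂ H z := by
    intro z h1 h2
    have : w z ∈ Complex.slitPlane := Or.inl (wprop z h1 h2).2.1
    have hw : DifferentiableAt ℂ w z := by simp only [w]; fun_prop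
    exact ((hw.clog this).const_mul _).cexp
  have hHb : ∀ z : ℂ, 0 ≤ σ * z.re → 0 ≤ z.im → ‖z‖ ^ (3 / 2 : ℝ) * κ ≤ (H z).re := by
    intro z h1 h2
    obtain ⟨q1, q2, q3⟩ := wprop z h1 h2
    refine le_trans ?_ (re_cpow_bound q1 q2)
    gcongr
  apply le_of_forall_delta (c := p * (H z).re)
  intro δ hδ
  let h : ℂ → ℂ := fun z => (a : ℂ) * (Complex.I * z) - (δ : ℂ) * H z
  have hre : ∀ z, (h z).re = -(a * z.im) - δ * (H z).re := by
    intro z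
    simp only [h, Complex.sub_re, Complex.re_ofReal_mul, Complex.I_mul_re]; ring
  have hhd : ∀ z : ℂ, 0 ≤ σ * z.re → 0 ≤ z.im → DifferentiableAt ℂ h z := by
    intro z h1 h2
    have := hHd z h1 h2
    simp only [h]; fun_prop
  have hbd : ∀ z : ℂ, 0 ≤ σ * z.re → 0 ≤ z.im →
      p * (h z).re ≤ - (p * a * z.im) - p * (δ * (‖z‖ ^ (3 / 2 : ℝ) * κ)) := by
    intro z h1 h2
    rw [hre]
    have := mul_le_mul_of_nonneg_left (mul_le_mul_of_nonneg_left (hHb z h1 h2) hδ.le) hp.le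
    nlinarith
  have main := max_principle hΩ (v := fun z => locMass p N f z * Real.exp (p * (h z).re))
    (M := max A M) (R := (a / (δ * κ)) ^ 2) ?_ ?_ ?_ ?_ z ⟨hz1, hz2⟩
  · simp only [hre] at main
    rw [mul_assoc, ← Real.exp_add]
    convert main using 3
    ring
  · refine (locMass_continuous hp hf).continuousOn.mul ?_
    have : ContinuousOn h (closure Ω) := fun z hz =>
      (hhd z (hcl hz).1 (hcl hz).2).continuousAt.continuousWithinAt
    exact ((Complex.continuous_re.comp_continuousOn this).const_mul p |>.rexp)
  · intro c _ r hr hb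
    exact submean_locMass hp hN hf hΩ
      (fun z hz => (hhd z hz.1.le hz.2.le).differentiableWithinAt) hr hb
  · intro z hz hzn
    obtain ⟨h1, h2⟩ := hcl hz
    have hb := hbd z h1 h2
    have hpos : 0 ≤ p * (δ * (‖z‖ ^ (3 / 2 : ℝ) * κ)) := by positivity
    by_cases him : z.im = 0
    · have hzr : z = (z.re : ℂ) := by apply Complex.ext <;> simp [him]
      have : Real.exp (p * (h z).re) ≤ 1 := by
        rw [Real.exp_le_one_iff]; rw [him] at hb; linarith
      refine le_trans ?_ (le_max_right A M)
      have h5 : locMass p N f z ≤ M := by rw [hzr]; exact hM _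
      calc _ ≤ M * 1 := mul_le_mul h5 this (Real.exp_pos _).le hM0
        _ = M := mul_one M
    · have him' : 0 < z.im := lt_of_le_of_ne h2 (Ne.symm him)
      have hre0 : σ * z.re = 0 := by
        by_contra hc
        exact hzn ⟨lt_of_le_of_ne h1 (Ne.symm hc), him'⟩
      have hre1 : z.re = 0 := by
        rcases mul_eq_zero.1 hre0 with h | h
        · simp [h] at hσ
        · exact h
      have hnz : ‖z‖ ≤ z.im := by
        have := Complex.norm_le_abs_re_add_abs_im z
        rwa [hre1, abs_zero, zero_add, abs_of_pos him'] at this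
      refine le_trans ?_ (le_max_left A M)
      calc _ ≤ (A * Real.exp (p * a * ‖z‖)) * Real.exp (p * (h z).re) := by gcongr; exact hA z
        _ ≤ (A * Real.exp (p * a * z.im)) * Real.exp (-(p * a * z.im)) := by
            gcongr; linarith
        _ = A := by rw [mul_assoc, ← Real.exp_add]; simp
  · intro z hz hzR
    have hb := hbd z hz.1.le hz.2.le
    refine le_trans ?_ (le_max_left A M)
    have h7 : a * ‖z‖ ≤ δ * (‖z‖ ^ (3 / 2 : ℝ) * κ) := by
      have hs : a / (δ * κ) ≤ √‖z‖ := Real.le_sqrt_of_sq_le hzR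
      rw [div_le_iff₀ (by positivity)] at hs
      have : ‖z‖ ^ (3 / 2 : ℝ) = √‖z‖ * ‖z‖ := by
        rw [Real.sqrt_eq_rpow]
        nth_rewrite 3 [← Real.rpow_one ‖z‖]
        rw [← Real.rpow_add_of_nonneg (norm_nonneg z) (by norm_num) (by norm_num)]
        norm_num
      rw [this]
      nlinarith [mul_le_mul_of_nonneg_right hs (norm_nonneg z)]
    have h8 : p * (h z).re ≤ -(p * a * ‖z‖) := by
      have := mul_le_mul_of_nonneg_left h7 hp.le
      have : 0 ≤ p * a * z.im := by have := hz.2; positivity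
      linarith
    calc _ ≤ (A * Real.exp (p * a * ‖z‖)) * Real.exp (-(p * a * ‖z‖)) := by gcongr; exact hA z
      _ = A := by rw [mul_assoc, ← Real.exp_add]; simp

theorem halfplane_bound {p N a A M : ℝ} (hp : 0 < p) (hN : 0 ≤ N) (ha : 0 < a)
    {f : ℂ → ℂ} (hf : Differentiable ℂ f)
    (hA : ∀ z, locMass p N f z ≤ A * Real.exp (p * a * ‖z‖)) (hM0 : 0 < M)
    (hM : ∀ x : ℝ, locMass p N f x ≤ M) (z : ℂ) (hz : 0 < z.im) :
    locMass p N f z * Real.exp (-(p * a * z.im)) ≤ M := by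
  set B := max A M with hB
  have hB0 : 0 < B := lt_max_of_lt_right hM0
  have hbdd : ∀ z : ℂ, 0 < z.im → locMass p N f z * Real.exp (-(p * a * z.im)) ≤ B := by
    intro z hz
    rcases lt_trichotomy z.re 0 with h | h | h
    · exact quadrant_bound (σ := -1) hp hN ha (by simp) hf hA hM z (by linarith) hz
    · have hnz : ‖z‖ ≤ z.im := by
        have := Complex.norm_le_abs_re_add_abs_im z
        rwa [h, abs_zero, zero_add, abs_of_pos hz] at this
      have hA0 : 0 ≤ A := by
        have := (locMass_nonneg hN f 0).trans (hA 0)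
        simpa using this
      refine le_trans ?_ (le_max_left A M)
      calc _ ≤ (A * Real.exp (p * a * ‖z‖)) * Real.exp (-(p * a * z.im)) := by gcongr; exact hA z
        _ ≤ (A * Real.exp (p * a * z.im)) * Real.exp (-(p * a * z.im)) := by gcongr
        _ = A := by rw [mul_assoc, ← Real.exp_add]; simp
    · exact quadrant_bound (σ := 1) hp hN ha (by simp) hf hA hM z (by linarith) hz
  let w : ℂ → ℂ := fun z => 1 - Complex.I * z
  have wre : ∀ z, (w z).re = 1 + z.im := by intro z; simp [w]
  have hw1 : ∀ z : ℂ, 0 ≤ z.im → 1 ≤ ‖w z‖ := by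
    intro z h
    refine le_trans ?_ (Complex.re_le_norm _)
    rw [wre]; linarith
  let Ω : Set ℂ := {z | 0 < z.im}
  have hΩ : IsOpen Ω := isOpen_lt (by fun_prop) (by fun_prop)
  have hcl : closure Ω ⊆ {z | 0 ≤ z.im} := by
    apply closure_minimal
    · intro z hz; exact le_of_lt (show 0 < z.im from hz)
    · exact isClosed_le (by fun_prop) (by fun_prop)
  apply le_of_forall_delta (c := p * Real.log ‖w z‖)
  intro δ hδ
  let h : ℂ → ℂ := fun z => (a : ℂ) * (Complex.I * z) - (δ : ℂ) * Complex.log (w z)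
  have hre : ∀ z, (h z).re = -(a * z.im) - δ * Real.log ‖w z‖ := by
    intro z
    simp only [h, Complex.sub_re, Complex.re_ofReal_mul, Complex.I_mul_re, Complex.log_re]; ring
  have hhd : ∀ z : ℂ, 0 ≤ z.im → DifferentiableAt ℂ h z := by
    intro z h1
    have : w z ∈ Complex.slitPlane := Or.inl (by rw [wre]; linarith)
    have hw : DifferentiableAt ℂ w z := by simp only [w]; fun_prop
    have := hw.clog this
    simp only [h]; fun_prop
  have main := max_principle hΩ (v := fun z => locMass p N f z * Real.exp (p * (h z).re))
    (M := M) (R := 1 + Real.exp (Real.log (B / M) / (p * δ))) ?_ ?_ ?_ ?_ z hz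
  · simp only [hre] at main
    rw [mul_assoc, ← Real.exp_add]
    convert main using 3
    ring
  · refine (locMass_continuous hp hf).continuousOn.mul ?_
    have : ContinuousOn h (closure Ω) := fun z hz =>
      (hhd z (hcl hz)).continuousAt.continuousWithinAt
    exact ((Complex.continuous_re.comp_continuousOn this).const_mul p |>.rexp)
  · intro c _ r hr hb
    exact submean_locMass hp hN hf hΩ
      (fun z hz => (hhd z (le_of_lt hz)).differentiableWithinAt) hr hb
  · intro z hz hzn
    have h2 : 0 ≤ z.im := hcl hz
    have him : z.im = 0 := le_antisymm (not_lt.1 hzn) h2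
    have hzr : z = (z.re : ℂ) := by apply Complex.ext <;> simp [him]
    have : Real.exp (p * (h z).re) ≤ 1 := by
      rw [Real.exp_le_one_iff, hre, him]
      have := mul_nonneg hp.le (mul_nonneg hδ.le (Real.log_nonneg (hw1 z h2)))
      linarith
    have h5 : locMass p N f z ≤ M := by rw [hzr]; exact hM _
    calc _ ≤ M * 1 := mul_le_mul h5 this (Real.exp_pos _).le hM0.le
      _ = M := mul_one M
  · intro z hz hzR
    have hz' : 0 < z.im := hz
    have h6 : Real.exp (Real.log (B / M) / (p * δ)) ≤ ‖w z‖ := by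
      have : ‖z‖ ≤ ‖w z‖ + 1 := by
        have h8 : Complex.I * z = 1 - w z := by simp [w]
        have h9 : ‖z‖ = ‖1 - w z‖ := by rw [← h8]; simp
        rw [h9]
        refine (norm_sub_le _ _).trans ?_
        simp [add_comm]
      linarith
    have h7 : Real.log (B / M) ≤ p * δ * Real.log ‖w z‖ := by
      have := Real.log_le_log (Real.exp_pos _) h6
      rw [Real.log_exp, div_le_iff₀ (by positivity)] at this
      linarith
    have h8 : Real.exp (-(p * δ * Real.log ‖w z‖)) ≤ M / B := by
      calc _ ≤ Real.exp (-Real.log (B / M)) := by gcongr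
        _ = M / B := by rw [Real.exp_neg, Real.exp_log (by positivity), inv_div]
    have e : Real.exp (p * (h z).re) =
        Real.exp (-(p * a * z.im)) * Real.exp (-(p * δ * Real.log ‖w z‖)) := by
      rw [← Real.exp_add, hre]; congr 1; ring
    simp only [e]
    rw [← mul_assoc]
    calc _ ≤ B * (M / B) := mul_le_mul (hbdd z hz) h8 (Real.exp_pos _).le hB0.le
      _ = M := by field_simp

theorem ofReal_locMass {p N : ℝ} (hp : 0 < p) (hN : 0 ≤ N) {f : ℂ → ℂ} (hf : Differentiable ℂ f)
    (z : ℂ) : ENNReal.ofReal (locMass p N f z) =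
      ∫⁻ t in Set.Ioc (-N) N, (‖f (z + t)‖₊ : ℝ≥0∞) ^ p := by
  have hfc := hf.continuous
  have hc : Continuous (fun t : ℝ => ‖f (z + t)‖ ^ p) := by
    refine Continuous.rpow_const ?_ (fun _ => Or.inr hp.le)
    fun_prop
  rw [locMass, intervalIntegral.integral_of_le (by linarith),
    ofReal_integral_eq_lintegral_ofReal]
  · apply lintegral_congr
    intro t
    rw [← ENNReal.ofReal_rpow_of_nonneg (norm_nonneg _) hp.le, ofReal_norm]
    rfl
  · exact (hc.continuousOn.integrableOn_compact isCompact_Icc).mono_set Set.Ioc_subset_Icc_self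
  · exact Filter.Eventually.of_forall (fun t => by positivity)

theorem locMass_growth {p N a C : ℝ} (hp : 0 < p) (hN : 0 ≤ N) (ha : 0 < a) (hC : 0 < C)
    {f : ℂ → ℂ} (hg : ∀ z : ℂ, ‖f z‖ ≤ C * Real.exp (a * ‖z‖)) (z : ℂ) :
    locMass p N f z ≤ ((C * Real.exp (a * N)) ^ p * (2 * N)) * Real.exp (p * a * ‖z‖) := by
  have h1 : ∀ t ∈ Set.uIoc (-N) N, ‖‖f (z + t)‖ ^ p‖ ≤
      (C * Real.exp (a * N)) ^ p * Real.exp (p * a * ‖z‖) := by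
    intro t ht
    rw [Set.uIoc_of_le (by linarith)] at ht
    have ht' : |t| ≤ N := abs_le.2 ⟨ht.1.le, ht.2⟩
    have hn : ‖z + t‖ ≤ ‖z‖ + N := by
      refine (norm_add_le _ _).trans ?_
      rw [Complex.norm_real, Real.norm_eq_abs]; linarith
    rw [Real.norm_of_nonneg (by positivity)]
    calc ‖f (z + t)‖ ^ p ≤ (C * Real.exp (a * (‖z‖ + N))) ^ p := by
          refine Real.rpow_le_rpow (norm_nonneg _) ((hg _).trans ?_) hp.le
          gcongr
      _ = ((C * Real.exp (a * N)) * Real.exp (a * ‖z‖)) ^ p := by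
          rw [mul_assoc, ← Real.exp_add]; congr 3; ring
      _ = _ := by
          rw [Real.mul_rpow (by positivity) (by positivity), ← Real.exp_mul]
          congr 2; ring
  have := intervalIntegral.norm_integral_le_of_norm_le_const h1
  refine (le_trans (le_abs_self _) this).trans (le_of_eq ?_)
  rw [abs_of_nonneg (by linarith)]; ring

theorem plancherel_polya {p : ℝ} (hp : 0 < p) {f : ℂ → ℂ} (hf : ExpTypePi f)
    (hLp : (∫⁻ x : ℝ, (‖f x‖₊ : ℝ≥0∞) ^ p) < ⊤) {y : ℝ} (hy : 0 < y) :
    (∫⁻ x : ℝ, (‖f (x + y * Complex.I)‖₊ : ℝ≥0∞) ^ p) ≤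
      ENNReal.ofReal (Real.exp (p * π * y)) * ∫⁻ x : ℝ, (‖f x‖₊ : ℝ≥0∞) ^ p := by
  set I := ∫⁻ x : ℝ, (‖f x‖₊ : ℝ≥0∞) ^ p with hI
  obtain ⟨hd, hgr⟩ := hf
  have step : ∀ N : ℝ, 0 ≤ N → locMass p N f (y * Complex.I) ≤ Real.exp (p * π * y) * I.toReal := by
    intro N hN
    have hreal : ∀ x : ℝ, locMass p N f x ≤ I.toReal := by
      intro x
      rw [← ENNReal.ofReal_le_iff_le_toReal hLp.ne, ofReal_locMass hp hN hd]
      refine (setLIntegral_le_lintegral _ _).trans (le_of_eq ?_)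
      rw [hI, ← lintegral_add_left_eq_self (fun t : ℝ => (‖f t‖₊ : ℝ≥0∞) ^ p) x]
      simp
    have hε : ∀ ε > 0, locMass p N f (y * Complex.I) * Real.exp (-(ε * (p * y))) ≤
        Real.exp (p * π * y) * I.toReal := by
      intro ε hε
      have ha : 0 < π + ε := by linarith [Real.pi_pos]
      obtain ⟨C, hC, hCg⟩ := hgr ε hε
      have key : ∀ η > 0, locMass p N f (y * Complex.I) * Real.exp (-(p * (π + ε) * y)) ≤
          I.toReal + η := by
        intro η hη
        have := halfplane_bound hp hN ha hd (locMass_growth hp hN ha hC hCg)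
          (M := I.toReal + η) (by positivity) (fun x => (hreal x).trans (by linarith))
          (y * Complex.I) (by simpa using hy)
        simpa using this
      have key2 := le_of_forall_pos_le_add key
      have e : Real.exp (-(p * (π + ε) * y)) =
          Real.exp (-(ε * (p * y))) * (Real.exp (p * π * y))⁻¹ := by
        rw [← Real.exp_neg, ← Real.exp_add]; congr 1; ring
      rw [e, ← mul_assoc, ← div_eq_mul_inv, div_le_iff₀ (Real.exp_pos _)] at key2
      linarith
    exact le_of_forall_delta hε
  have hcov : AECover (volume : Measure ℝ) Filter.atTop (fun n : ℕ => Set.Ioc (-(n : ℝ)) n) :=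
    aecover_Ioc (Filter.tendsto_neg_atTop_atBot.comp tendsto_natCast_atTop_atTop)
      tendsto_natCast_atTop_atTop
  have hfc := hd.continuous
  have hmeas : AEMeasurable (fun x : ℝ => (‖f (x + y * Complex.I)‖₊ : ℝ≥0∞) ^ p) := by
    refine Measurable.aemeasurable ?_
    have : Continuous (fun x : ℝ => f (x + y * Complex.I)) := by fun_prop
    exact (this.nnnorm.measurable.coe_nnreal_ennreal).pow_const p
  refine le_of_tendsto (hcov.lintegral_tendsto_of_countably_generated hmeas)
    (Filter.Eventually.of_forall fun n => ?_)
  have h1 := ofReal_locMass hp (Nat.cast_nonneg n : (0 : ℝ) ≤ n) hd (y * Complex.I)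
  have h2 : (∫⁻ x in Set.Ioc (-(n : ℝ)) n, (‖f (x + y * Complex.I)‖₊ : ℝ≥0∞) ^ p) =
      ENNReal.ofReal (locMass p n f (y * Complex.I)) := by
    rw [h1]
    simp only [add_comm]
  rw [h2]
  refine (ENNReal.ofReal_le_ofReal (step n (Nat.cast_nonneg n))).trans (le_of_eq ?_)
  rw [ENNReal.ofReal_mul (Real.exp_pos _).le, ENNReal.ofReal_toReal hLp.ne]

theorem upper_isometry {p : ℝ} (hp : 0 < p) {f : ℂ → ℂ} (hf : ExpTypePi f)
    (hLp : (∫⁻ x : ℝ, (‖f x‖₊ : ℝ≥0∞) ^ p) < ⊤) :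
    (⨆ (y : ℝ) (_ : 0 < y), ∫⁻ x : ℝ,
        (‖Complex.exp ((Real.pi : ℂ) * Complex.I * (x + y * Complex.I)) *
            f (x + y * Complex.I)‖₊ : ℝ≥0∞) ^ p) =
      (∫⁻ x : ℝ, (‖f x‖₊ : ℝ≥0∞) ^ p) := by
  have hfc := hf.1.continuous
  apply le_antisymm
  · refine iSup₂_le fun y hy => ?_
    have e : ∀ x : ℝ, (‖Complex.exp ((Real.pi : ℂ) * Complex.I * (x + y * Complex.I)) *
            f (x + y * Complex.I)‖₊ : ℝ≥0∞) ^ p =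
        ENNReal.ofReal (Real.exp (-(p * π * y))) * (‖f (x + y * Complex.I)‖₊ : ℝ≥0∞) ^ p := by
      intro x
      rw [nnnorm_mul, ENNReal.coe_mul, ENNReal.mul_rpow_of_nonneg _ _ hp.le]
      congr 1
      rw [← enorm_eq_nnnorm, ← ofReal_norm, Complex.norm_exp,
        ENNReal.ofReal_rpow_of_nonneg (Real.exp_pos _).le hp.le, ← Real.exp_mul]
      congr 2
      simp
      ring
    simp only [e]
    rw [lintegral_const_mul' _ _ ENNReal.ofReal_ne_top]
    refine (mul_le_mul_right (plancherel_polya hp hf hLp hy) _).trans (le_of_eq ?_)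
    rw [← mul_assoc, ← ENNReal.ofReal_mul (Real.exp_pos _).le, ← Real.exp_add]
    simp
  · let y : ℕ → ℝ := fun n => 1 / ((n : ℝ) + 1)
    have hy : ∀ n, 0 < y n := fun n => by positivity
    have hy0 : Filter.Tendsto y Filter.atTop (nhds 0) := tendsto_one_div_add_atTop_nhds_zero_nat
    let F : ℝ → ℝ → ℝ≥0∞ := fun y x =>
      (‖Complex.exp ((Real.pi : ℂ) * Complex.I * (x + y * Complex.I)) *
            f (x + y * Complex.I)‖₊ : ℝ≥0∞) ^ p
    have hF1 : ∀ y, Measurable (F y) := by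
      intro y
      have : Continuous (fun x : ℝ =>
        Complex.exp ((Real.pi : ℂ) * Complex.I * (x + y * Complex.I)) *
            f (x + y * Complex.I)) := by fun_prop
      exact (this.nnnorm.measurable.coe_nnreal_ennreal).pow_const p
    have hF2 : ∀ x : ℝ, Filter.Tendsto (fun n => F (y n) x) Filter.atTop
        (nhds ((‖f x‖₊ : ℝ≥0∞) ^ p)) := by
      intro x
      have h1 : Continuous (fun y : ℝ =>
        Complex.exp ((Real.pi : ℂ) * Complex.I * (x + y * Complex.I)) *
            f (x + y * Complex.I)) := by fun_prop
      have h2 : Continuous (fun y : ℝ => F y x) :=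
        ENNReal.continuous_rpow_const.comp (ENNReal.continuous_coe.comp h1.nnnorm)
      have h3 := (h2.tendsto 0).comp hy0
      have : ‖Complex.exp ((Real.pi : ℂ) * Complex.I * (x + (0 : ℝ) * Complex.I))‖₊ = 1 := by
        apply NNReal.eq
        simp [Complex.norm_exp]
      have h4 : F 0 x = (‖f x‖₊ : ℝ≥0∞) ^ p := by
        simp only [F, nnnorm_mul]
        rw [this]
        simp
      rw [← h4]
      exact h3
    calc (∫⁻ x : ℝ, (‖f x‖₊ : ℝ≥0∞) ^ p)
        = ∫⁻ x : ℝ, Filter.liminf (fun n => F (y n) x) Filter.atTop :=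
          lintegral_congr fun x => ((hF2 x).liminf_eq).symm
      _ ≤ Filter.liminf (fun n => ∫⁻ x : ℝ, F (y n) x) Filter.atTop :=
          lintegral_liminf_le fun n => hF1 (y n)
      _ ≤ ⨆ (y : ℝ) (_ : 0 < y), ∫⁻ x : ℝ, F y x := by
          refine Filter.liminf_le_of_frequently_le'
            (Filter.Frequently.of_forall fun n => ?_)
          exact le_iSup₂ (f := fun (y : ℝ) (_ : 0 < y) => ∫⁻ x : ℝ, F y x) (y n) (hy n)

/-- For `f ∈ Eᵖ`, the map `f ↦ e^{iπz} f(z)` is an isometry into `Hᵖ(ℂ₊)` and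
`f ↦ e^{-iπz} f(z)` is an isometry into `Hᵖ(ℂ₋)`:
the `Hᵖ` quasi-norms (to the `p`-th power, as suprema over horizontal lines)
equal `∫_ℝ |f(x)|^p dx`. -/
theorem isometry_into_hardy_halfplanes (p : ℝ) (hp : 0 < p) (f : ℂ → ℂ)
    (hf : ExpTypePi f)
    (hLp : (∫⁻ x : ℝ, (‖f x‖₊ : ℝ≥0∞) ^ p) < ⊤) :
    (⨆ (y : ℝ) (_ : 0 < y), ∫⁻ x : ℝ,
        (‖Complex.exp ((Real.pi : ℂ) * Complex.I * (x + y * Complex.I)) *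
            f (x + y * Complex.I)‖₊ : ℝ≥0∞) ^ p) =
      (∫⁻ x : ℝ, (‖f x‖₊ : ℝ≥0∞) ^ p) ∧
    (⨆ (y : ℝ) (_ : y < 0), ∫⁻ x : ℝ,
        (‖Complex.exp (-((Real.pi : ℂ) * Complex.I * (x + y * Complex.I))) *
            f (x + y * Complex.I)‖₊ : ℝ≥0∞) ^ p) =
      (∫⁻ x : ℝ, (‖f x‖₊ : ℝ≥0∞) ^ p) := by
  refine ⟨upper_isometry hp hf hLp, ?_⟩
  have hg : ExpTypePi (fun z => f (-z)) := by
    refine ⟨hf.1.comp differentiable_neg, fun ε hε => ?_⟩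
    obtain ⟨C, hC, h⟩ := hf.2 ε hε
    exact ⟨C, hC, fun z => by simpa using h (-z)⟩
  have hI : (∫⁻ x : ℝ, (‖f (-(x : ℂ))‖₊ : ℝ≥0∞) ^ p) = ∫⁻ x : ℝ, (‖f x‖₊ : ℝ≥0∞) ^ p := by
    rw [← lintegral_neg_eq_self (fun x : ℝ => (‖f x‖₊ : ℝ≥0∞) ^ p)]
    simp
  have h := upper_isometry hp hg (by rw [hI]; exact hLp)
  rw [hI] at h
  rw [← h, ← (Equiv.neg ℝ).iSup_comp]
  refine iSup_congr fun y => ?_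
  simp only [Equiv.neg_apply, neg_lt_zero]
  refine iSup_congr fun _ => ?_
  rw [← lintegral_neg_eq_self]
  refine lintegral_congr fun x => ?_
  have e : ((-x : ℝ) : ℂ) + ((-y : ℝ) : ℂ) * Complex.I = -(x + y * Complex.I) := by
    push_cast; ring
  rw [e]
  congr 4
  ring_nf
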